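/- arXiv:1408.2883 — 4 statements merged into one kernel-verified Lean document; each statement's English description precedes it below -/
import Mathlib

section
/- Let (Ω, μ) be a probability space and let A : ℕ → Set Ω be a sequence of measurable sets. Let 𝒜 be the Boolean algebra of subsets of Ω generated by {A_n : n ∈ ℕ} (the smallest collection containing each A_n and Ω, closed under finite unions and complements). Then there exists a map Φ from 𝒜 to subsets of [0,1) such that for all S, T ∈ 𝒜: (1) Φ(S) is a finite union of half-open intervals [a, b) ⊆ [0,1); (2) the Lebesgue measure of Φ(S) equals μ(S); (3) Φ(S ∪ T) = Φ(S) ∪ Φ(T); and (4) Φ(Ω \ S) = [0,1) \ Φ(S). -/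
open MeasureTheory

/-- The Boolean algebra of subsets of `Ω` generated by a countable family `A : ℕ → Set Ω`:
the smallest collection containing each `A n` and `Ω` itself, closed under finite unions
and complements. -/
inductive GenBoolAlg {Ω : Type*} (A : ℕ → Set Ω) : Set Ω → Prop
  | basic (n : ℕ) : GenBoolAlg A (A n)
  | univ : GenBoolAlg A Set.univ
  | union {S T : Set Ω} : GenBoolAlg A S → GenBoolAlg A T → GenBoolAlg A (S ∪ T)
  | compl {S : Set Ω} : GenBoolAlg A S → GenBoolAlg A Sᶜ

/-- A finite union of half-open intervals of the real line. -/
def IsFiniteUnionIco (s : Set ℝ) : Prop :=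
  ∃ (k : ℕ) (a b : Fin k → ℝ), s = ⋃ i, Set.Ico (a i) (b i)

theorem isFiniteUnionIco_empty : IsFiniteUnionIco ∅ :=
  ⟨0, Fin.elim0, Fin.elim0, by simp⟩

theorem isFiniteUnionIco_Ico (a b : ℝ) : IsFiniteUnionIco (Set.Ico a b) :=
  ⟨1, fun _ => a, fun _ => b, by simp [Set.iUnion_const]⟩

theorem IsFiniteUnionIco.union {s t : Set ℝ} (hs : IsFiniteUnionIco s)
    (ht : IsFiniteUnionIco t) : IsFiniteUnionIco (s ∪ t) := by
  obtain ⟨k, a, b, rfl⟩ := hs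
  obtain ⟨m, c, d, rfl⟩ := ht
  refine ⟨k + m, Fin.append a c, Fin.append b d, Set.ext fun x => ?_⟩
  simp only [Set.mem_union, Set.mem_iUnion]
  constructor
  · rintro (⟨i, hi⟩ | ⟨i, hi⟩)
    · exact ⟨Fin.castAdd m i, by simpa using hi⟩
    · exact ⟨Fin.natAdd k i, by simpa using hi⟩
  · rintro ⟨i, hi⟩
    induction i using Fin.addCases with
    | left i => exact Or.inl ⟨i, by simpa using hi⟩
    | right i => exact Or.inr ⟨i, by simpa using hi⟩

theorem IsFiniteUnionIco.measurableSet {s : Set ℝ} (hs : IsFiniteUnionIco s) :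
    MeasurableSet s := by
  obtain ⟨k, a, b, rfl⟩ := hs
  exact MeasurableSet.iUnion fun _ => measurableSet_Ico

section Cell

variable {Ω : Type*} [MeasurableSpace Ω] (μ : Measure Ω)

/-- The interval starting at `l` of length `μ B` is cut into an interval representing `B ∩ A 0`
followed by one representing `B \ A 0`, and so on; `cell μ n A B l x` is the subset of `B`
represented by the interval containing `x` after `n` cuts. -/
noncomputable def cell : ℕ → (ℕ → Set Ω) → Set Ω → ℝ → ℝ → Set Ω
  | 0, _, B, _, _ => B
  | n + 1, A, B, l, x =>
    open scoped Classical in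
    if x < l + μ.real (B ∩ A 0) then cell n (fun i => A (i + 1)) (B ∩ A 0) l x
    else cell n (fun i => A (i + 1)) (B \ A 0) (l + μ.real (B ∩ A 0)) x

theorem cell_of_lt (n : ℕ) {A : ℕ → Set Ω} {B : Set Ω} {l x : ℝ}
    (h : x < l + μ.real (B ∩ A 0)) :
    cell μ (n + 1) A B l x = cell μ n (fun i => A (i + 1)) (B ∩ A 0) l x :=
  if_pos h

theorem cell_of_not_lt (n : ℕ) {A : ℕ → Set Ω} {B : Set Ω} {l x : ℝ}
    (h : ¬x < l + μ.real (B ∩ A 0)) :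
    cell μ (n + 1) A B l x =
      cell μ n (fun i => A (i + 1)) (B \ A 0) (l + μ.real (B ∩ A 0)) x :=
  if_neg h

theorem cell_subset (n : ℕ) (A : ℕ → Set Ω) (B : Set Ω) (l x : ℝ) : cell μ n A B l x ⊆ B := by
  induction n generalizing A B l with
  | zero => exact subset_rfl
  | succ n ih =>
    rw [cell]
    split_ifs
    · exact (ih _ _ _).trans Set.inter_subset_left
    · exact (ih _ _ _).trans Set.sdiff_subset

theorem cell_succ_subset (n : ℕ) (A : ℕ → Set Ω) (B : Set Ω) (l x : ℝ) :
    cell μ (n + 1) A B l x ⊆ cell μ n A B l x := by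
  induction n generalizing A B l with
  | zero => exact cell_subset μ 1 A B l x
  | succ n ih =>
    by_cases h : x < l + μ.real (B ∩ A 0)
    · rw [cell_of_lt μ (n + 1) h, cell_of_lt μ n h]
      exact ih _ _ _
    · rw [cell_of_not_lt μ (n + 1) h, cell_of_not_lt μ n h]
      exact ih _ _ _

theorem cell_antitone (A : ℕ → Set Ω) (B : Set Ω) (l x : ℝ) :
    Antitone fun n => cell μ n A B l x :=
  antitone_nat_of_succ_le fun n => cell_succ_subset μ n A B l x

theorem cell_succ_decides (n : ℕ) (A : ℕ → Set Ω) (B : Set Ω) (l x : ℝ) :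
    cell μ (n + 1) A B l x ⊆ A n ∨ cell μ (n + 1) A B l x ⊆ (A n)ᶜ := by
  induction n generalizing A B l with
  | zero =>
    rw [cell]
    split_ifs
    · exact Or.inl Set.inter_subset_right
    · exact Or.inr fun _ h => h.2
  | succ n ih =>
    rw [cell]
    split_ifs
    · exact ih (fun i => A (i + 1)) _ _
    · exact ih (fun i => A (i + 1)) _ _

theorem exists_cell_decides {A : ℕ → Set Ω} {S : Set Ω} (hS : GenBoolAlg A S) (B : Set Ω)
    (l : ℝ) : ∃ n, ∀ x, cell μ n A B l x ⊆ S ∨ cell μ n A B l x ⊆ Sᶜ := by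
  induction hS with
  | basic n => exact ⟨n + 1, fun x => cell_succ_decides μ n A B l x⟩
  | univ => exact ⟨0, fun x => Or.inl (Set.subset_univ _)⟩
  | compl _ ih =>
    obtain ⟨n, hn⟩ := ih
    exact ⟨n, fun x => by rw [compl_compl]; exact (hn x).symm⟩
  | union _ _ ihS ihT =>
    obtain ⟨n, hn⟩ := ihS
    obtain ⟨m, hm⟩ := ihT
    refine ⟨max n m, fun x => ?_⟩
    have h₁ := cell_antitone μ A B l x (le_max_left n m)
    have h₂ := cell_antitone μ A B l x (le_max_right n m)
    rcases hn x with h | h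
    · exact Or.inl ((h₁.trans h).trans Set.subset_union_left)
    rcases hm x with h' | h'
    · exact Or.inl ((h₂.trans h').trans Set.subset_union_right)
    · rw [Set.compl_union]
      exact Or.inr (Set.subset_inter (h₁.trans h) (h₂.trans h'))

variable [IsFiniteMeasure μ]

theorem cell_nonempty (n : ℕ) {A : ℕ → Set Ω} (hA : ∀ n, MeasurableSet (A n)) {B : Set Ω}
    {l x : ℝ} (hx : x ∈ Set.Ico l (l + μ.real B)) : (cell μ n A B l x).Nonempty := by
  induction n generalizing A B l with
  | zero =>
    rw [cell, Set.nonempty_iff_ne_empty]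
    rintro rfl
    simp at hx
  | succ n ih =>
    have h := measureReal_inter_add_sdiff (μ := μ) (s := B) (hA 0)
    rw [cell]
    split_ifs with hlt
    · exact ih (fun i => hA (i + 1)) ⟨hx.1, hlt⟩
    · exact ih (fun i => hA (i + 1)) ⟨not_lt.1 hlt, by linarith [hx.2]⟩

/-- If every cell after `n` cuts is either contained in `S` or disjoint from `S`, then the cells
contained in `S` are represented by finitely many intervals of total length `μ (S ∩ B)`. -/
theorem cells_subset_volume (n : ℕ) {A : ℕ → Set Ω} (hA : ∀ n, MeasurableSet (A n)) (B S : Set Ω)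
    (l : ℝ) (hS : ∀ x ∈ Set.Ico l (l + μ.real B),
      cell μ n A B l x ⊆ S ∨ cell μ n A B l x ⊆ Sᶜ) :
    IsFiniteUnionIco {x ∈ Set.Ico l (l + μ.real B) | cell μ n A B l x ⊆ S} ∧
      volume {x ∈ Set.Ico l (l + μ.real B) | cell μ n A B l x ⊆ S} = μ (S ∩ B) := by
  induction n generalizing A B l with
  | zero =>
    simp only [cell] at hS ⊢
    by_cases hB : B ⊆ S
    · simp only [hB, and_true, Set.ofPred_mem_eq, Set.inter_eq_right.2 hB]
      exact ⟨isFiniteUnionIco_Ico _ _, by simp⟩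
    · simp only [hB, and_false, Set.ofPred_false, measure_empty]
      refine ⟨isFiniteUnionIco_empty, ?_⟩
      rcases (measureReal_nonneg (μ := μ) (s := B)).eq_or_lt with h | h
      · exact (measure_mono_null Set.inter_subset_right
          ((measureReal_eq_zero_iff).1 h.symm)).symm
      · have hd := (hS l ⟨le_rfl, by linarith⟩).resolve_left hB
        rw [(Set.disjoint_left.2 fun _ h₁ h₂ => hd h₂ h₁ : Disjoint S B).inter_eq, measure_empty]
  | succ n ih =>
    have h := measureReal_inter_add_sdiff (μ := μ) (s := B) (hA 0)
    have h₀ := measureReal_nonneg (μ := μ) (s := B ∩ A 0)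
    have h₁ := measureReal_nonneg (μ := μ) (s := B \ A 0)
    obtain ⟨f₁, v₁⟩ := ih (fun i => hA (i + 1)) (B ∩ A 0) l fun x hx => by
      have := hS x ⟨hx.1, by linarith [hx.2]⟩
      rwa [cell_of_lt μ n hx.2] at this
    obtain ⟨f₂, v₂⟩ := ih (fun i => hA (i + 1)) (B \ A 0) (l + μ.real (B ∩ A 0)) fun x hx => by
      have := hS x ⟨by linarith [hx.1], by linarith [hx.2]⟩
      rwa [cell_of_not_lt μ n hx.1.not_gt] at this
    have hsplit : {x ∈ Set.Ico l (l + μ.real B) | cell μ (n + 1) A B l x ⊆ S} =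
        {x ∈ Set.Ico l (l + μ.real (B ∩ A 0)) |
          cell μ n (fun i => A (i + 1)) (B ∩ A 0) l x ⊆ S} ∪
        {x ∈ Set.Ico (l + μ.real (B ∩ A 0)) (l + μ.real (B ∩ A 0) + μ.real (B \ A 0)) |
          cell μ n (fun i => A (i + 1)) (B \ A 0) (l + μ.real (B ∩ A 0)) x ⊆ S} := by
      rw [add_assoc, h]
      ext x
      simp only [Set.mem_union, Set.mem_ofPred_eq, Set.mem_Ico, cell]
      split_ifs with hlt
      · have : x < l + μ.real B := by linarith
        simp [hlt, this, not_le.2 hlt]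
      · have : l ≤ x := by linarith
        simp [hlt, this, not_lt.1 hlt]
    rw [hsplit]
    refine ⟨f₁.union f₂, ?_⟩
    rw [measure_union _ f₂.measurableSet, v₁, v₂, ← Set.inter_assoc, ← Set.inter_sdiff_assoc,
      measure_inter_add_sdiff _ (hA 0)]
    exact Set.disjoint_left.2 fun x hx hx' => absurd hx.1.2 hx'.1.1.not_gt

end Cell

/-- The Wiener–Carathéodory measure algebra homomorphism: for a probability space `(Ω, μ)`
and a sequence of measurable sets `A n`, there is a map `Φ` from the Boolean algebra generated
by the `A n` to subsets of `[0,1)` that sends each set to a finite union of half-open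
intervals `[a, b) ⊆ [0,1)`, preserves measure (with respect to Lebesgue measure), preserves
finite unions, and preserves complements. -/
theorem exists_boolean_measure_algebra_hom
    {Ω : Type*} [MeasurableSpace Ω] (μ : Measure Ω) [IsProbabilityMeasure μ]
    (A : ℕ → Set Ω) (hA : ∀ n, MeasurableSet (A n)) :
    ∃ Φ : Set Ω → Set ℝ,
      (∀ S : Set Ω, GenBoolAlg A S →
        ((∃ (k : ℕ) (a b : Fin k → ℝ), Φ S = ⋃ i, Set.Ico (a i) (b i)) ∧
          Φ S ⊆ Set.Ico (0 : ℝ) 1) ∧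
        volume (Φ S) = μ S) ∧
      (∀ S T : Set Ω, GenBoolAlg A S → GenBoolAlg A T → Φ (S ∪ T) = Φ S ∪ Φ T) ∧
      (∀ S : Set Ω, GenBoolAlg A S → Φ (Set.univ \ S) = Set.Ico (0 : ℝ) 1 \ Φ S) := by
  let c : ℕ → ℝ → Set Ω := fun n x => cell μ n A Set.univ 0 x
  have anti : ∀ x, Antitone fun n => c n x := fun x => cell_antitone μ A Set.univ 0 x
  have hI : Set.Ico (0 : ℝ) (0 + μ.real Set.univ) = Set.Ico 0 1 := by simp
  have hne : ∀ n, ∀ x ∈ Set.Ico (0 : ℝ) 1, (c n x).Nonempty := fun n x hx =>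
    cell_nonempty μ n hA (hI ▸ hx)
  have hex : ∀ S n x, x ∈ Set.Ico (0 : ℝ) 1 → (c n x ⊆ S ∨ c n x ⊆ Sᶜ) →
      ((∃ m, c m x ⊆ S) ↔ c n x ⊆ S) := by
    refine fun S n x hx hd => ⟨fun ⟨m, hm⟩ => hd.resolve_right fun hn => ?_, fun h => ⟨n, h⟩⟩
    obtain ⟨y, hy⟩ := hne (max n m) x hx
    exact hn (anti x (le_max_left n m) hy) (hm (anti x (le_max_right n m) hy))
  have hcompl : ∀ S : Set Ω, GenBoolAlg A S → ∀ x ∈ Set.Ico (0 : ℝ) 1,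
      ((∃ m, c m x ⊆ Sᶜ) ↔ ¬ ∃ m, c m x ⊆ S) := by
    intro S hS x hx
    obtain ⟨n, hn⟩ := exists_cell_decides μ hS Set.univ 0
    have hd : c n x ⊆ S ∨ c n x ⊆ Sᶜ := hn x
    rw [hex S n x hx hd, hex Sᶜ n x hx (by rw [compl_compl]; exact hd.symm)]
    refine ⟨fun h h' => ?_, hd.resolve_left⟩
    obtain ⟨y, hy⟩ := hne n x hx
    exact h hy (h' hy)
  refine ⟨fun S => {x ∈ Set.Ico (0 : ℝ) 1 | ∃ n, c n x ⊆ S}, fun S hS => ?_,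
    fun S T hS hT => ?_, fun S hS => ?_⟩
  · obtain ⟨n, hn⟩ := exists_cell_decides μ hS Set.univ 0
    have key := cells_subset_volume μ n hA Set.univ S 0 fun x _ => hn x
    rw [hI, Set.inter_univ] at key
    have heq : {x ∈ Set.Ico (0 : ℝ) 1 | ∃ n, c n x ⊆ S} =
        {x ∈ Set.Ico (0 : ℝ) 1 | cell μ n A Set.univ 0 x ⊆ S} :=
      Set.ext fun x => and_congr_right fun hx => hex S n x hx (hn x)
    simp only [heq]
    exact ⟨⟨key.1, fun x hx => hx.1⟩, key.2⟩
  · ext x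
    simp only [Set.mem_union, Set.mem_ofPred_eq, ← and_or_left]
    refine and_congr_right fun hx => ⟨fun ⟨n, hn⟩ => ?_, ?_⟩
    · by_contra! hcon
      obtain ⟨i, hi⟩ := (hcompl S hS x hx).2 fun ⟨m, hm⟩ => hcon.1 m hm
      obtain ⟨j, hj⟩ := (hcompl T hT x hx).2 fun ⟨m, hm⟩ => hcon.2 m hm
      obtain ⟨y, hy⟩ := hne (max n (max i j)) x hx
      rcases hn (anti x (le_max_left _ _) hy) with h | h
      · exact hi (anti x ((le_max_left i j).trans (le_max_right n _)) hy) h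
      · exact hj (anti x ((le_max_right i j).trans (le_max_right n _)) hy) h
    · rintro (⟨n, hn⟩ | ⟨n, hn⟩)
      · exact ⟨n, hn.trans Set.subset_union_left⟩
      · exact ⟨n, hn.trans Set.subset_union_right⟩
  · ext x
    simp only [← Set.compl_eq_univ_sdiff, Set.mem_sdiff, Set.mem_ofPred_eq, not_and]
    exact and_congr_right fun hx => (hcompl S hS x hx).trans ⟨fun h _ => h, fun h => h hx⟩
end

section
/- (Local mass distribution principle.) Let μ be a mass distribution on 2^ℕ, let α ≥ 0, let C > 0, and let A ⊆ 2^ℕ be a Borel set such that the upper α-density d̄_α(μ,x) < C for every x ∈ A. Then H^α(A) ≥ μ(A)/C. In particular, if μ(A) > 0 then the Hausdorff dimension of A is at least α. -/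
open MeasureTheory Filter Set
open scoped ENNReal NNReal Topology

attribute [local instance] PiNat.metricSpace

/-- The upper `α`-density of a measure `μ` on Cantor space at a point `x`:
`limsup_{r↓0} μ(B(x,r)) / r^α`, where `B(x,r)` is the closed ball of radius `r` about `x`. -/
noncomputable def upperDensity (μ : Measure (ℕ → Bool)) (α : ℝ) (x : ℕ → Bool) : ℝ≥0∞ :=
  limsup (fun r : ℝ => μ (Metric.closedBall x r) / ENNReal.ofReal (r ^ α)) (𝓝[>] 0)

/-- If `μ (closedBall x r) ≤ C * r ^ α` for all `x ∈ s` and all small `r`, uniformly in `x`, then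
`μ s / C` is a lower bound for the `α`-dimensional Hausdorff measure of `s`. -/
theorem measure_div_le_hausdorffMeasure_of_closedBall_le {X : Type*} [MetricSpace X]
    [MeasurableSpace X] [BorelSpace X] (μ : Measure X) {α : ℝ} (hα : 0 ≤ α) {C : ℝ≥0}
    {s : Set X} {ε : ℝ} (hε : 0 < ε)
    (h : ∀ x ∈ s, ∀ r, 0 < r → r < ε →
      μ (Metric.closedBall x r) ≤ C * ENNReal.ofReal (r ^ α)) :
    μ s / C ≤ μH[α] s := by
  have key : (C : ℝ≥0∞)⁻¹ • OuterMeasure.restrict s μ.toOuterMeasure ≤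
      OuterMeasure.mkMetric fun d => d ^ α := by
    refine OuterMeasure.le_mkMetric _ _ (ENNReal.ofReal (ε / 2)) (by simpa using hε) fun t ht => ?_
    rw [smul_apply, OuterMeasure.restrict_apply, smul_eq_mul, mul_comm,
      ← div_eq_mul_inv]
    refine ENNReal.div_le_of_le_mul' ?_
    rcases (t ∩ s).eq_empty_or_nonempty with hts | ⟨x, hxt, hxs⟩
    · simp [hts]
    have hfin : Metric.ediam t ≠ ∞ := ne_top_of_le_ne_top ENNReal.ofReal_ne_top ht
    have hlt : Metric.diam t < ε :=
      (ENNReal.toReal_le_of_le_ofReal (by positivity) ht).trans_lt (by linarith)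
    have hle : ∀ᶠ r in 𝓝[>] Metric.diam t, μ (t ∩ s) ≤ C * ENNReal.ofReal (r ^ α) := by
      filter_upwards [Ioo_mem_nhdsGT hlt] with r hr
      refine (measure_mono fun y hy => ?_).trans
        (h x hxs r (Metric.diam_nonneg.trans_lt hr.1) hr.2)
      exact (Metric.dist_le_diam_of_mem' hfin hy.1 hxt).trans hr.1.le
    have hlim : Tendsto (fun r : ℝ => (C : ℝ≥0∞) * ENNReal.ofReal (r ^ α)) (𝓝[>] Metric.diam t)
        (𝓝 (C * ENNReal.ofReal (Metric.diam t ^ α))) :=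
      (ENNReal.Tendsto.const_mul (ENNReal.tendsto_ofReal
        (Real.continuous_rpow_const hα).continuousAt.tendsto)
        (Or.inr ENNReal.coe_ne_top)).mono_left nhdsWithin_le_nhds
    have := ge_of_tendsto hlim hle
    rwa [← ENNReal.ofReal_rpow_of_nonneg Metric.diam_nonneg hα, Metric.diam,
      ENNReal.ofReal_toReal hfin] at this
  have := key s
  rw [smul_apply, OuterMeasure.restrict_apply, inter_self, smul_eq_mul, mul_comm,
    ← div_eq_mul_inv] at this
  rwa [Measure.hausdorffMeasure, ← OuterMeasure.coe_mkMetric]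

/-- If the upper `α`-density of `μ` is less than `C` at every point of `s`, then `μ s / C` is a
lower bound for the `α`-dimensional Hausdorff measure of `s`. -/
theorem measure_div_le_hausdorffMeasure_of_limsup_lt {X : Type*} [MetricSpace X]
    [MeasurableSpace X] [BorelSpace X] (μ : Measure X) {α : ℝ} (hα : 0 ≤ α) {C : ℝ≥0}
    {s : Set X}
    (h : ∀ x ∈ s, limsup (fun r : ℝ => μ (Metric.closedBall x r) / ENNReal.ofReal (r ^ α))
      (𝓝[>] 0) < C) :
    μ s / C ≤ μH[α] s := by
  let S : ℕ → Set X := fun k => {x ∈ s | ∀ r : ℝ, 0 < r → r < 1 / (k + 1 : ℝ) →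
    μ (Metric.closedBall x r) ≤ C * ENNReal.ofReal (r ^ α)}
  have hmono : Monotone S := fun k l hkl x hx =>
    ⟨hx.1, fun r hr hrl => hx.2 r hr (hrl.trans_le (Nat.one_div_le_one_div hkl))⟩
  have hunion : ⋃ k, S k = s := by
    refine Subset.antisymm (iUnion_subset fun k x hx => hx.1) fun x hx => ?_
    obtain ⟨δ, hδ, hsub⟩ :=
      mem_nhdsGT_iff_exists_Ioo_subset.1 (eventually_lt_of_limsup_lt (h x hx))
    obtain ⟨k, hk⟩ := exists_nat_one_div_lt (show (0 : ℝ) < δ from hδ)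
    refine mem_iUnion.2 ⟨k, hx, fun r hr hrk => ?_⟩
    have hr' : μ (Metric.closedBall x r) / ENNReal.ofReal (r ^ α) < C := hsub ⟨hr, hrk.trans hk⟩
    exact (ENNReal.div_le_iff (by simpa using Real.rpow_pos_of_pos hr α)
      ENNReal.ofReal_ne_top).1 hr'.le
  rw [← hunion, hmono.measure_iUnion, ENNReal.iSup_div, hunion]
  exact iSup_le fun k => (measure_div_le_hausdorffMeasure_of_closedBall_le μ hα
    Nat.one_div_pos_of_nat fun x hx => hx.2).trans (measure_mono fun x hx => hx.1)

/-- Local mass distribution principle: if `μ` is a mass distribution on Cantor space,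
`α ≥ 0`, `C > 0`, and `A` is a Borel set on which the upper `α`-density of `μ` is everywhere
`< C`, then the `α`-dimensional Hausdorff measure of `A` is at least `μ(A)/C`; in particular,
if `μ(A) > 0` then the Hausdorff dimension of `A` is at least `α`. -/
theorem local_mass_distribution_principle
    (μ : Measure (ℕ → Bool))
    (hμ0 : 0 < μ Set.univ) (hμfin : μ Set.univ < ∞)
    (α : ℝ) (hα : 0 ≤ α) (C : ℝ≥0) (hC : 0 < C)
    (A : Set (ℕ → Bool)) (hA : MeasurableSet A)
    (hdens : ∀ x ∈ A, upperDensity μ α x < (C : ℝ≥0∞)) :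
    μ A / (C : ℝ≥0∞) ≤ μH[α] A ∧ (0 < μ A → ENNReal.ofReal α ≤ dimH A) := by
  have hle : μ A / (C : ℝ≥0∞) ≤ μH[α] A :=
    measure_div_le_hausdorffMeasure_of_limsup_lt μ hα hdens
  refine ⟨hle, fun hpos => ?_⟩
  have hne : μH[α] A ≠ 0 := ((ENNReal.div_pos hpos.ne' ENNReal.coe_ne_top).trans_le hle).ne'
  lift α to ℝ≥0 using hα
  simpa using le_dimH_of_hausdorffMeasure_ne_zero hne
end

section
/- Let γ ∈ (0,1) and ε > 0 be such that γ + ε = p/q with p, q positive natural numbers and p ≤ q. Let Z = {n ∈ ℕ : n mod q < p} and let A = [T_Z] ⊆ 2^ℕ. Then there exists a probability measure μ on 2^ℕ concentrated on A (namely, the measure splitting mass in half at each branching node of T_Z, i.e. the image of the uniform (fair-coin) product measure on 2^ℕ under the embedding that writes the successive bits into the positions belonging to Z and fills the remaining positions with 0) such that the γ-energy I_γ(μ) is finite. -/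
open MeasureTheory Filter Set
open scoped ENNReal NNReal Topology

attribute [local instance] PiNat.metricSpace

/-- The `α`-potential of a point `x` with respect to `μ`: `∫ dμ(y) / υ(x,y)^α`. -/
noncomputable def potential (μ : Measure (ℕ → Bool)) (α : ℝ) (x : ℕ → Bool) : ℝ≥0∞ :=
  ∫⁻ y, (edist x y ^ α)⁻¹ ∂μ

/-- The `α`-energy of `μ`: `I_α(μ) = ∫ φ_α(x) dμ(x)`. -/
noncomputable def energy (μ : Measure (ℕ → Bool)) (α : ℝ) : ℝ≥0∞ :=
  ∫⁻ y, potential μ α y ∂μ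

/-- The measure on `2^ℕ` whose `n`-th bits are independent, being a fair coin if `P n` and `false`
otherwise. -/
noncomputable def treeMeasure (P : ℕ → Prop) [DecidablePred P] : Measure (ℕ → Bool) :=
  Measure.infinitePi fun n =>
    if P n then (PMF.uniformOfFintype Bool).toMeasure else Measure.dirac false

section treeMeasure

variable (P : ℕ → Prop) [DecidablePred P]

instance isProbabilityMeasure_bit (n : ℕ) : IsProbabilityMeasure
    (if P n then (PMF.uniformOfFintype Bool).toMeasure else Measure.dirac false) := by
  split_ifs <;> infer_instance

instance isProbabilityMeasure_treeMeasure : IsProbabilityMeasure (treeMeasure P) := by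
  unfold treeMeasure; infer_instance

theorem measurableSet_piNat_cylinder (x : ℕ → Bool) (n : ℕ) :
    MeasurableSet (PiNat.cylinder x n) := by
  rw [PiNat.cylinder_eq_pi]
  exact .pi (Finset.countable_toSet _) fun _ _ => measurableSet_singleton _

theorem uniformOfFintype_bool_toMeasure_singleton (b : Bool) :
    (PMF.uniformOfFintype Bool).toMeasure {b} = 2⁻¹ := by
  rw [PMF.toMeasure_apply_singleton _ _ (measurableSet_singleton b)]
  simp

theorem treeMeasure_cylinder (x : ℕ → Bool) (n : ℕ) :
    treeMeasure P (PiNat.cylinder x n) =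
      ∏ i ∈ Finset.range n, if P i then 2⁻¹ else Measure.dirac false {x i} := by
  rw [PiNat.cylinder_eq_pi, treeMeasure,
    Measure.infinitePi_pi _ fun _ _ => measurableSet_singleton _]
  refine Finset.prod_congr rfl fun i _ => ?_
  split_ifs
  · exact uniformOfFintype_bool_toMeasure_singleton _
  · rfl

theorem treeMeasure_cylinder_le (x : ℕ → Bool) (n : ℕ) :
    treeMeasure P (PiNat.cylinder x n) ≤ 2⁻¹ ^ n.count P := by
  rw [treeMeasure_cylinder, Nat.count_eq_card_filter_range, ← Finset.prod_const,
    Finset.prod_filter]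
  refine Finset.prod_le_prod' fun i _ => ?_
  split_ifs
  · rfl
  · exact prob_le_one

theorem treeMeasure_cylinder_of_mem (x : ℕ → Bool) (n : ℕ)
    (hx : ∀ i < n, ¬ P i → x i = false) :
    treeMeasure P (PiNat.cylinder x n) = 2⁻¹ ^ n.count P := by
  rw [treeMeasure_cylinder, Nat.count_eq_card_filter_range, ← Finset.prod_const,
    Finset.prod_filter]
  refine Finset.prod_congr rfl fun i hi => ?_
  split_ifs with h
  · rfl
  · simp [hx i (Finset.mem_range.1 hi) h]

theorem treeMeasure_paths : treeMeasure P {x | ∀ n, ¬ P n → x n = false} = 1 := by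
  rw [← mem_ae_iff_prob_eq_one (by measurability)]
  refine ae_all_iff.2 fun n => ?_
  by_cases h : P n
  · simp [h]
  have hmap : (treeMeasure P).map (fun x => x n) = Measure.dirac false := by
    simpa [h, treeMeasure] using Measure.infinitePi_map_eval (fun n =>
      if P n then (PMF.uniformOfFintype Bool).toMeasure else Measure.dirac false) n
  have : ∀ᵐ b ∂(treeMeasure P).map (fun x => x n), b = false := by simp [hmap, ae_dirac_eq]
  filter_upwards [ae_of_ae_map (measurable_pi_apply n).aemeasurable this] with x hx _ using hx

end treeMeasure

theorem edist_eq_of_ne {x y : ℕ → Bool} (h : x ≠ y) :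
    edist x y = 2⁻¹ ^ PiNat.firstDiff x y := by
  rw [edist_dist]
  change ENNReal.ofReal (PiNat.dist.dist x y) = _
  rw [PiNat.dist_eq_of_ne h, ENNReal.ofReal_pow (by norm_num), one_div,
    ENNReal.ofReal_inv_of_pos two_pos, ENNReal.ofReal_ofNat]

theorem inv_edist_rpow_le_tsum {α : ℝ} (hα : 0 ≤ α) (x y : ℕ → Bool) :
    (edist x y ^ α)⁻¹ ≤
      ∑' n : ℕ, (PiNat.cylinder x n).indicator (fun _ => (2 : ℝ≥0∞) ^ (α * n)) y := by
  rcases eq_or_ne x y with rfl | h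
  · refine le_top.trans_eq (Eq.symm (top_unique ?_))
    rw [← ENNReal.tsum_const_eq_top_of_ne_zero (α := ℕ) one_ne_zero]
    refine ENNReal.tsum_le_tsum fun n => ?_
    rw [indicator_of_mem (PiNat.self_mem_cylinder x n)]
    exact ENNReal.rpow_zero.symm.trans_le <|
      ENNReal.rpow_le_rpow_of_exponent_le one_le_two (by positivity)
  · refine le_trans (le_of_eq ?_) (ENNReal.le_tsum (PiNat.firstDiff x y))
    have hy : y ∈ PiNat.cylinder x (PiNat.firstDiff x y) :=
      (PiNat.mem_cylinder_comm _ _ _).1 (PiNat.mem_cylinder_firstDiff x y)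
    rw [indicator_of_mem hy, edist_eq_of_ne h, ← ENNReal.inv_rpow, ← ENNReal.inv_pow, inv_inv,
      mul_comm, ENNReal.rpow_mul, ENNReal.rpow_natCast]

theorem potential_le_tsum (μ : Measure (ℕ → Bool)) {α : ℝ} (hα : 0 ≤ α) (x : ℕ → Bool) :
    potential μ α x ≤ ∑' n : ℕ, (2 : ℝ≥0∞) ^ (α * n) * μ (PiNat.cylinder x n) := by
  refine (lintegral_mono (inv_edist_rpow_le_tsum hα x)).trans_eq ?_
  rw [lintegral_tsum fun n =>
    (measurable_const.indicator (measurableSet_piNat_cylinder x n)).aemeasurable]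
  simp only [lintegral_indicator_const (measurableSet_piNat_cylinder x _)]

theorem mul_div_le_count_mod_lt {p q : ℕ} (hpq : p ≤ q) (n : ℕ) :
    p * (n / q) ≤ n.count fun k => k % q < p := by
  refine le_trans ?_ (Nat.count_monotone _ (Nat.mul_div_le n q))
  induction n / q with
  | zero => simp
  | succ m ih =>
    rw [Nat.mul_succ, Nat.mul_succ, Nat.count_add]
    refine add_le_add ih ?_
    calc p = p.count fun k => (q * m + k) % q < p := by
          refine (Nat.count_iff_forall.2 fun k hk => ?_).symm
          rw [Nat.mul_add_mod]
          exact (Nat.mod_le _ _).trans_lt hk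
      _ ≤ _ := Nat.count_monotone _ hpq

theorem mul_div_sub_le_count_mod_lt {p q : ℕ} (hq : 0 < q) (hpq : p ≤ q) (n : ℕ) :
    (p / q : ℝ) * n - p ≤ (n.count fun k => k % q < p : ℕ) := by
  have hq' : (0 : ℝ) < q := by exact_mod_cast hq
  have h : (n : ℝ) / q ≤ (n / q : ℕ) + 1 := by
    rw [div_le_iff₀ hq']
    exact_mod_cast (Nat.lt_div_mul_add hq (a := n)).le.trans_eq (by ring)
  have hc : (p : ℝ) * (n / q : ℕ) ≤ (n.count fun k => k % q < p : ℕ) := by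
    exact_mod_cast mul_div_le_count_mod_lt hpq n
  calc (p / q : ℝ) * n - p = p * (n / q) - p := by ring
    _ ≤ p * ((n / q : ℕ) + 1) - p := by gcongr
    _ = p * (n / q : ℕ) := by ring
    _ ≤ _ := hc

theorem rpow_mul_pow_count_le {γ ε : ℝ} {p q : ℕ} (hq : 0 < q) (hpq : p ≤ q)
    (hsum : γ + ε = (p : ℝ) / (q : ℝ)) (n : ℕ) :
    (2 : ℝ≥0∞) ^ (γ * n) * 2⁻¹ ^ (n.count fun k => k % q < p) ≤
      2 ^ (p : ℝ) * (2 ^ (-ε)) ^ n := by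
  have hc := mul_div_sub_le_count_mod_lt hq hpq n
  rw [← hsum] at hc
  rw [← ENNReal.inv_pow, ← ENNReal.rpow_natCast, ← ENNReal.rpow_neg, ← ENNReal.rpow_natCast,
    ← ENNReal.rpow_mul, ← ENNReal.rpow_add _ _ two_ne_zero ENNReal.ofNat_ne_top,
    ← ENNReal.rpow_add _ _ two_ne_zero ENNReal.ofNat_ne_top]
  exact ENNReal.rpow_le_rpow_of_exponent_le one_le_two (by linarith)

theorem tsum_rpow_mul_pow_count_lt_top {γ ε : ℝ} (hε : 0 < ε) {p q : ℕ} (hq : 0 < q)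
    (hpq : p ≤ q) (hsum : γ + ε = (p : ℝ) / (q : ℝ)) :
    ∑' n : ℕ, (2 : ℝ≥0∞) ^ (γ * n) * 2⁻¹ ^ (n.count fun k => k % q < p) < ∞ := by
  refine (ENNReal.tsum_le_tsum (rpow_mul_pow_count_le hq hpq hsum)).trans_lt ?_
  rw [ENNReal.tsum_mul_left, ENNReal.tsum_geometric]
  refine ENNReal.mul_lt_top (ENNReal.rpow_lt_top_of_nonneg p.cast_nonneg ENNReal.ofNat_ne_top) ?_
  rw [ENNReal.inv_lt_top, tsub_pos_iff_lt]
  exact ENNReal.rpow_lt_one_of_one_lt_of_neg ENNReal.one_lt_two (neg_lt_zero.2 hε)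

/-- Let `γ ∈ (0,1)` and `ε > 0` with `γ + ε = p/q`, `p, q` positive naturals, `p ≤ q`.
Let `Z = {n : n % q < p}` and `A = [T_Z] = {x : ∀ n ∉ Z, x n = false}`.  Then there is a
probability measure `μ` concentrated on `A` — namely the natural measure on `[T_Z]` splitting
the mass in half at each branching node of `T_Z`, i.e. giving each cylinder `[σ]` with
`σ ∈ T_Z` the mass `2^{-#(Z ∩ [0, |σ|))}` — whose `γ`-energy is finite. -/
theorem exists_measure_on_tree_paths_energy_lt_top
    (γ ε : ℝ) (hγ : γ ∈ Set.Ioo (0 : ℝ) 1) (hε : 0 < ε)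
    (p q : ℕ) (hp : 0 < p) (hq : 0 < q) (hpq : p ≤ q)
    (hsum : γ + ε = (p : ℝ) / (q : ℝ)) :
    ∃ μ : Measure (ℕ → Bool), IsProbabilityMeasure μ ∧
      μ {x : ℕ → Bool | ∀ n : ℕ, ¬ n % q < p → x n = false} = 1 ∧
      (∀ σ : List Bool, (∀ n (h : n < σ.length), ¬ n % q < p → σ.get ⟨n, h⟩ = false) →
        μ {x : ℕ → Bool | ∀ n (h : n < σ.length), x n = σ.get ⟨n, h⟩} =
          (2 : ℝ≥0∞)⁻¹ ^ ((Finset.range σ.length).filter (fun n => n % q < p)).card) ∧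
      energy μ γ < ∞ := by
  refine ⟨treeMeasure fun n => n % q < p, inferInstance, treeMeasure_paths _, fun σ hσ => ?_, ?_⟩
  · have hcyl : {x : ℕ → Bool | ∀ n (h : n < σ.length), x n = σ.get ⟨n, h⟩} =
        PiNat.cylinder (fun n => σ.getD n false) σ.length := by
      ext x
      refine forall₂_congr fun n h => ?_
      simp [h]
    rw [hcyl, treeMeasure_cylinder_of_mem, Nat.count_eq_card_filter_range]
    intro i hi hP
    simpa [hi] using hσ i hi hP
  · refine lt_of_le_of_lt ?_ (tsum_rpow_mul_pow_count_lt_top hε hq hpq hsum)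
    refine (lintegral_mono fun x => (potential_le_tsum _ hγ.1.le x).trans <|
      ENNReal.tsum_le_tsum fun n =>
        mul_le_mul_right (treeMeasure_cylinder_le _ x n) _).trans_eq ?_
    simp
end

section
/- Let p, q be positive natural numbers with p ≤ q and let Z = {n ∈ ℕ : n mod q < p}. Then the closed set [T_Z] ⊆ 2^ℕ has Hausdorff dimension at least p/q. -/
open MeasureTheory Set
open scoped ENNReal NNReal

attribute [local instance] PiNat.metricSpace

/-- The sequence of binary digits of `x` read off, in increasing order, at the positions `n` with
`n % q < p`. -/
def readDigits (p q : ℕ) (x : ℕ → Bool) (k : ℕ) : Fin 2 :=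
  if x (q * (k / p) + k % p) then 1 else 0

theorem mul_readDigits_index_le {p q : ℕ} (hpq : p ≤ q) (k : ℕ) :
    p * (q * (k / p) + k % p) ≤ q * k := by
  calc p * (q * (k / p) + k % p) = q * (p * (k / p)) + p * (k % p) := by ring
    _ ≤ q * (p * (k / p)) + q * (k % p) := by gcongr
    _ = q * k := by rw [← mul_add, Nat.div_add_mod]

theorem abs_ofDigits_readDigits_sub_le {p q : ℕ} (hq : 0 < q) (hpq : p ≤ q)
    {x y : ℕ → Bool} {n : ℕ} (h : ∀ i < n, x i = y i) :
    |Real.ofDigits (readDigits p q x) - Real.ofDigits (readDigits p q y)| ≤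
      ((1 / 2 : ℝ) ^ n) ^ ((p : ℝ) / q) := by
  have hq' : (0 : ℝ) < q := by exact_mod_cast hq
  have hagree : ∀ k < ⌈(n * p : ℝ) / q⌉₊, readDigits p q x k = readDigits p q y k := by
    intro k hk
    have hk' : q * k < p * n := by
      rw [Nat.lt_ceil, lt_div_iff₀ hq'] at hk
      have : k * q < n * p := by exact_mod_cast hk
      linarith
    have hlt := Nat.lt_of_mul_lt_mul_left ((mul_readDigits_index_le hpq k).trans_lt hk')
    simp only [readDigits, h _ hlt]
  refine (Real.abs_ofDigits_sub_ofDigits_le hagree).trans ?_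
  rw [← Real.rpow_natCast (1 / 2) n, ← Real.rpow_mul (by norm_num), Nat.cast_ofNat, ← inv_pow,
    ← one_div, ← Real.rpow_natCast]
  refine Real.rpow_le_rpow_of_exponent_ge (by norm_num) (by norm_num) ?_
  rw [← mul_div_assoc]
  exact Nat.le_ceil _

theorem holderWith_ofDigits_readDigits {p q : ℕ} (hq : 0 < q) (hpq : p ≤ q) :
    HolderWith 1 ((p : ℝ≥0) / q) fun x : ℕ → Bool => Real.ofDigits (readDigits p q x) := by
  intro x y
  rw [ENNReal.coe_one, one_mul, edist_dist, edist_dist,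
    ENNReal.ofReal_rpow_of_nonneg dist_nonneg (by positivity)]
  refine ENNReal.ofReal_le_ofReal ?_
  rw [Real.dist_eq]
  push_cast
  rcases eq_or_ne x y with rfl | hne
  · simp only [sub_self, abs_zero]
    positivity
  · rw [PiNat.dist_eq_of_ne hne]
    exact abs_ofDigits_readDigits_sub_le hq hpq fun i hi => PiNat.apply_eq_of_lt_firstDiff hi

theorem exists_readDigits_eq {p q : ℕ} (hp : 0 < p) (hpq : p ≤ q) (d : ℕ → Fin 2) :
    ∃ x : ℕ → Bool, (∀ n, ¬ n % q < p → x n = false) ∧ readDigits p q x = d := by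
  refine ⟨fun n => decide (n % q < p ∧ d (p * (n / q) + n % q) = 1), fun n hn => by simp [hn], ?_⟩
  funext k
  have hk : k % p < p := Nat.mod_lt k hp
  have hkq : k % p < q := hk.trans_le hpq
  have hmod : (q * (k / p) + k % p) % q = k % p := by
    rw [Nat.mul_add_mod, Nat.mod_eq_of_lt hkq]
  have hdiv : (q * (k / p) + k % p) / q = k / p := by
    rw [Nat.mul_add_div (hp.trans_le hpq), Nat.div_eq_of_lt hkq, add_zero]
  simp only [readDigits, hmod, hdiv, Nat.div_add_mod, hk, true_and, decide_eq_true_eq]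
  split_ifs <;> omega

/-- Let `p, q` be positive naturals with `p ≤ q` and `Z = {n : n % q < p}`.  Then the set
`[T_Z] = {x ∈ 2^ℕ : ∀ n ∉ Z, x n = false}` of paths through the tree `T_Z` has Hausdorff
dimension at least `p/q` (with respect to the standard ultrametric on Cantor space). -/
theorem dimH_tree_paths_ge
    (p q : ℕ) (hp : 0 < p) (hq : 0 < q) (hpq : p ≤ q) :
    (p : ℝ≥0∞) / (q : ℝ≥0∞) ≤ dimH {x : ℕ → Bool | ∀ n : ℕ, ¬ n % q < p → x n = false} := by
  set S := {x : ℕ → Bool | ∀ n : ℕ, ¬ n % q < p → x n = false}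
  have hr : (0 : ℝ≥0) < (p : ℝ≥0) / q := by positivity
  have himage : Icc (0 : ℝ) 1 ⊆ (fun x => Real.ofDigits (readDigits p q x)) '' S := by
    intro t ht
    obtain ⟨d, -, rfl⟩ := Real.ofDigits_SurjOn one_lt_two ht
    obtain ⟨x, hxS, rfl⟩ := exists_readDigits_eq hp hpq d
    exact ⟨x, hxS, rfl⟩
  have hIcc : dimH (Icc (0 : ℝ) 1) = 1 := by
    rw [Real.dimH_of_nonempty_interior (by simp), Module.finrank_self, Nat.cast_one]
  have hle : 1 ≤ dimH S / ((p : ℝ≥0) / q : ℝ≥0) :=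
    hIcc.ge.trans <| (dimH_mono himage).trans <|
      (holderWith_ofDigits_readDigits hq hpq).dimH_image_le hr S
  rw [ENNReal.le_div_iff_mul_le (Or.inl (by exact_mod_cast hr.ne')) (Or.inl ENNReal.coe_ne_top),
    one_mul, ENNReal.coe_div (by exact_mod_cast hq.ne')] at hle
  exact_mod_cast hle
end
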